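/- The composition of the Radon transform with its dual (back-projection) acting on f ∈ 𝒮(ℝⁿ), n ≥ 2, equals a constant multiple of the convolution of f with the Riesz potential V(x) = 1/|x|: (f^♯)^♭(x) = aₙ (f * V)(x), where aₙ = 2π^{(n-1)/2}/Γ((n-1)/2). -/

import Mathlib

open MeasureTheory
open scoped RealInnerProductSpace

/-- The Radon tomogram of `f` along the unit vector `ξ` at signed distance `X`. -/
noncomputable def tomogram {n : ℕ} (f : EuclideanSpace ℝ (Fin n) → ℝ)
    (ξ : EuclideanSpace ℝ (Fin n)) (X : ℝ) : ℝ :=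
  ∫ y : ((ℝ ∙ ξ)ᗮ : Submodule ℝ (EuclideanSpace ℝ (Fin n))),
    f (X • ξ + (y : EuclideanSpace ℝ (Fin n)))

/-- The back-projection of the Radon transform of `f` at `x`:
`(f^♯)^♭(x) = ∫_{S^{n-1}} f^♯(ξ·x, ξ) dξ`, with `dξ` the surface measure. -/
noncomputable def backprojRadon {n : ℕ} (f : EuclideanSpace ℝ (Fin n) → ℝ)
    (x : EuclideanSpace ℝ (Fin n)) : ℝ :=
  ∫ ξ : Metric.sphere (0 : EuclideanSpace ℝ (Fin n)) 1,
    tomogram f (ξ : EuclideanSpace ℝ (Fin n)) (⟪(ξ : EuclideanSpace ℝ (Fin n)), x⟫ : ℝ)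
    ∂((volume : Measure (EuclideanSpace ℝ (Fin n))).toSphere)

variable {E : Type*} [NormedAddCommGroup E] [InnerProductSpace ℝ E]

/-- A linear isometry carrying `v` to `w` restricts to the orthogonal complements. -/
lemma exists_orthogonal_linearIsometryEquiv (U : E ≃ₗᵢ[ℝ] E) {v w : E} (h : U v = w) :
    ∃ ψ : ((ℝ ∙ v)ᗮ : Submodule ℝ E) ≃ₗᵢ[ℝ] ((ℝ ∙ w)ᗮ : Submodule ℝ E),
      ∀ y, (ψ y : E) = U y := by
  have hmap : (ℝ ∙ v)ᗮ.map (U.toLinearEquiv : E →ₗ[ℝ] E) = (ℝ ∙ w)ᗮ := by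
    ext y
    simp only [Submodule.mem_map, Submodule.mem_orthogonal_singleton_iff_inner_right, ← h]
    constructor
    · rintro ⟨z, hz, rfl⟩
      exact (U.inner_map_map v z).trans hz
    · intro hy
      refine ⟨U.symm y, ?_, U.apply_symm_apply y⟩
      rw [← U.inner_map_map, U.apply_symm_apply, hy]
  exact ⟨(U.submoduleMap _).trans (LinearIsometryEquiv.ofEq _ _ hmap), fun y => rfl⟩

lemma reflection_sphere {e : E} (he : ‖e‖ = 1) (ξ : Metric.sphere (0 : E) 1) :
    (ℝ ∙ (e - (ξ : E)))ᗮ.reflection e = ξ :=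
  Submodule.reflection_sub (by simp [he])

variable [FiniteDimensional ℝ E]

lemma finrank_orthogonal_singleton {e : E} (he : ‖e‖ = 1) :
    Module.finrank ℝ ((ℝ ∙ e)ᗮ : Submodule ℝ E) = Module.finrank ℝ E - 1 := by
  have h := (ℝ ∙ e).finrank_add_finrank_orthogonal
  rw [finrank_span_singleton (by rintro rfl; simp at he)] at h
  omega


/-- The orthogonal group of a finite-dimensional real inner product space is compact. -/
lemma compactSpace_unitary_clm [CompleteSpace E] : CompactSpace (unitary (E →L[ℝ] E)) := by
  have : ProperSpace (E →L[ℝ] E) := FiniteDimensional.proper ℝ _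
  refine isCompact_iff_compactSpace.1 (Metric.isCompact_of_isClosed_isBounded
    (s := (unitary (E →L[ℝ] E) : Set (E →L[ℝ] E)))
    isClosed_unitary ?_)
  refine (Metric.isBounded_closedBall (x := (0 : E →L[ℝ] E)) (r := 1)).subset fun u hu => ?_
  rw [mem_closedBall_zero_iff]
  refine ContinuousLinearMap.opNorm_le_bound _ zero_le_one fun v => ?_
  rw [one_mul, u.norm_map_of_mem_unitary hu]

variable [MeasurableSpace E] [BorelSpace E]

open Submodule in
/-- Two rotation-invariant measures which agree on radial functions are equal. -/
theorem MeasureTheory.Measure.ext_of_radial {μ ν : Measure E} [SFinite μ] [SFinite ν]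
    {e : E} (he : ‖e‖ = 1)
    (hμ : ∀ U : E ≃ₗᵢ[ℝ] E, MeasurePreserving U μ μ)
    (hν : ∀ U : E ≃ₗᵢ[ℝ] E, MeasurePreserving U ν ν)
    (h : ∀ φ : ℝ → ENNReal, Measurable φ → ∫⁻ y, φ ‖y‖ ∂μ = ∫⁻ y, φ ‖y‖ ∂ν) : μ = ν := by
  have : CompleteSpace E := FiniteDimensional.complete ℝ E
  let G := unitary (E →L[ℝ] E)
  have : CompactSpace G := compactSpace_unitary_clm
  have : ProperSpace (E →L[ℝ] E) := FiniteDimensional.proper ℝ _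
  let : MeasurableSpace G := borel G
  have : BorelSpace G := ⟨rfl⟩
  let m : Measure G := Measure.haar
  have hact : Continuous fun p : G × E => ((p.1⁻¹ : G) : E →L[ℝ] E) p.2 := by fun_prop
  have hm0 : m Set.univ ≠ 0 := by simp [m, NeZero.ne]
  have hm1 : m Set.univ ≠ ⊤ := measure_ne_top _ _
  refine Measure.ext_of_lintegral _ fun g hg => ?_
  have hg' : Measurable fun p : G × E => g (((p.1⁻¹ : G) : E →L[ℝ] E) p.2) :=
    hg.comp hact.measurable
  let φ : ℝ → ENNReal := fun r => ∫⁻ U : G, g (((U⁻¹ : G) : E →L[ℝ] E) (r • e)) ∂m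
  have hφ : Measurable φ := by
    have : Measurable fun p : ℝ × G => g (((p.2⁻¹ : G) : E →L[ℝ] E) (p.1 • e)) :=
      hg'.comp (g := fun p : G × E => g (((p.1⁻¹ : G) : E →L[ℝ] E) p.2))
        (f := fun p : ℝ × G => (p.2, p.1 • e)) (by fun_prop)
    exact this.lintegral_prod_right'
  have hφy (y : E) : ∫⁻ U : G, g (((U⁻¹ : G) : E →L[ℝ] E) y) ∂m = φ ‖y‖ := by
    let V : E ≃ₗᵢ[ℝ] E := (ℝ ∙ (‖y‖ • e - y))ᗮ.reflection
    have hV : V (‖y‖ • e) = y := reflection_sub (by simp [norm_smul, he])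
    let W : G := Unitary.linearIsometryEquiv.symm V
    have hW : ((W : G) : E →L[ℝ] E) (‖y‖ • e) = y := hV
    change _ = ∫⁻ U : G, g (((U⁻¹ : G) : E →L[ℝ] E) (‖y‖ • e)) ∂m
    rw [← lintegral_mul_left_eq_self _ W]
    refine lintegral_congr fun U => ?_
    have : (((W * U)⁻¹ : G) : E →L[ℝ] E) ((W : E →L[ℝ] E) (‖y‖ • e)) =
        ((U⁻¹ : G) : E →L[ℝ] E) (‖y‖ • e) := by
      rw [← mul_apply_eq_comp, ← Submonoid.coe_mul]
      simp
    rw [← this, hW]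
  have key (κ : Measure E) [SFinite κ] (hκ : ∀ U : E ≃ₗᵢ[ℝ] E, MeasurePreserving U κ κ) :
      m Set.univ * ∫⁻ y, g y ∂κ = ∫⁻ y, φ ‖y‖ ∂κ := by
    calc m Set.univ * ∫⁻ y, g y ∂κ = ∫⁻ U : G, ∫⁻ y, g y ∂κ ∂m := by
          rw [lintegral_const, mul_comm]
      _ = ∫⁻ U : G, ∫⁻ y, g (((U⁻¹ : G) : E →L[ℝ] E) y) ∂κ ∂m :=
          lintegral_congr fun U =>
            ((hκ (Unitary.linearIsometryEquiv U⁻¹)).lintegral_comp hg).symm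
      _ = ∫⁻ y, ∫⁻ U : G, g (((U⁻¹ : G) : E →L[ℝ] E) y) ∂m ∂κ :=
          lintegral_lintegral_swap hg'.aemeasurable
      _ = _ := lintegral_congr hφy
  exact (ENNReal.mul_right_inj hm0 hm1).1 (by rw [key μ hμ, key ν hν, h φ hφ])

/-- The surface measure on the unit sphere, pushed to the ambient space, is invariant under
linear isometries. -/
lemma measurePreserving_sphere_linearIsometryEquiv (U : E ≃ₗᵢ[ℝ] E) :
    MeasurePreserving
      (fun ξ : Metric.sphere (0 : E) 1 => (⟨U ξ, by simp⟩ : Metric.sphere (0 : E) 1))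
      (volume : Measure E).toSphere (volume : Measure E).toSphere := by
  have hmeas : Measurable
      (fun ξ : Metric.sphere (0 : E) 1 => (⟨U ξ, by simp⟩ : Metric.sphere (0 : E) 1)) := by
    refine Measurable.subtype_mk ?_
    exact U.continuous.measurable.comp measurable_subtype_coe
  refine ⟨hmeas, Measure.ext fun s hs => ?_⟩
  rw [Measure.map_apply hmeas hs, Measure.toSphere_apply' _ (hmeas hs),
    Measure.toSphere_apply' _ hs]
  congr 1
  symm
  rw [← (LinearIsometryEquiv.measurePreserving U).measure_preimage_equiv
    (f := U.toHomeomorph.toMeasurableEquiv)]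
  congr 1
  ext y
  simp only [Set.mem_smul, Set.mem_image, Set.mem_preimage, Subtype.exists, exists_and_right,
    exists_eq_right]
  constructor
  · rintro ⟨r, hr, z, ⟨h1, h2⟩, h3⟩
    refine ⟨r, hr, U.symm z, ⟨by simpa using h1, by simpa using h2⟩, ?_⟩
    apply U.injective
    simpa using h3
  · rintro ⟨r, hr, z, ⟨h1, h2⟩, rfl⟩
    exact ⟨r, hr, U z, ⟨by simpa using h1, h2⟩, by simp⟩

/-- Integration of a radial function in polar coordinates. -/
lemma lintegral_fun_norm_addHaar [Nontrivial E] (μ : Measure E) [μ.IsAddHaarMeasure]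
    {φ : ℝ → ENNReal} (hφ : Measurable φ) :
    ∫⁻ y, φ ‖y‖ ∂μ = μ.toSphere Set.univ *
      ∫⁻ r in Set.Ioi (0 : ℝ), ENNReal.ofReal (r ^ (Module.finrank ℝ E - 1)) * φ r := by
  calc ∫⁻ y, φ ‖y‖ ∂μ = ∫⁻ y : ({(0)}ᶜ : Set E), φ ‖y.1‖ ∂(μ.comap (↑)) := by
        rw [lintegral_subtype_comap (measurableSet_singleton _).compl fun x ↦ φ (‖x‖),
          restrict_compl_singleton]
    _ = ∫⁻ p, φ p.2 ∂μ.toSphere.prod (.volumeIoiPow (Module.finrank ℝ E - 1)) := by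
        simpa using (μ.measurePreserving_homeomorphUnitSphereProd.lintegral_comp_emb
          (Homeomorph.measurableEmbedding _) (φ ∘ Subtype.val ∘ Prod.snd))
    _ = μ.toSphere Set.univ *
          ∫⁻ r : Set.Ioi (0 : ℝ), φ r ∂.volumeIoiPow (Module.finrank ℝ E - 1) := by
        rw [lintegral_prod _ (by fun_prop)]
        simp [mul_comm]
    _ = _ := by
        simp only [Measure.volumeIoiPow]
        rw [lintegral_withDensity_eq_lintegral_mul _ (by fun_prop) (by fun_prop)]
        simp only [Pi.mul_apply]
        rw [lintegral_subtype_comap measurableSet_Ioi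
          fun a ↦ ENNReal.ofReal (a ^ (Module.finrank ℝ E - 1)) * φ a]

/-- Integrals over the hyperplane `wᗮ`, `w = U v`, pull back to `vᗮ` under the isometry `U`. -/
lemma lintegral_orthogonal_comp (U : E ≃ₗᵢ[ℝ] E) {v w : E} (h : U v = w) (g : E → ENNReal)
    (hg : Measurable g) :
    ∫⁻ y : ((ℝ ∙ v)ᗮ : Submodule ℝ E), g (U y) = ∫⁻ y : ((ℝ ∙ w)ᗮ : Submodule ℝ E), g y := by
  obtain ⟨ψ, hψ⟩ := exists_orthogonal_linearIsometryEquiv U h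
  simpa [hψ] using ψ.measurePreserving.lintegral_comp (hg.comp measurable_subtype_coe)

lemma integral_orthogonal_comp (U : E ≃ₗᵢ[ℝ] E) {v w : E} (h : U v = w) (g : E → ℝ) :
    ∫ y : ((ℝ ∙ v)ᗮ : Submodule ℝ E), g (U y) = ∫ y : ((ℝ ∙ w)ᗮ : Submodule ℝ E), g y := by
  obtain ⟨ψ, hψ⟩ := exists_orthogonal_linearIsometryEquiv U h
  rw [← ψ.measurePreserving.integral_comp ψ.toHomeomorph.measurableEmbedding]
  simp [hψ]

/-- The image measure on `E` of the surface measure times Lebesgue measure on a fixed hyperplane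
`eᗮ`, under the reflections exchanging `e` and the points of the sphere. -/
noncomputable def hyperplaneMeasure (e : E) : Measure E :=
  ((volume : Measure E).toSphere.prod (volume : Measure ((ℝ ∙ e)ᗮ : Submodule ℝ E))).map
    fun p => (ℝ ∙ (e - (p.1 : E)))ᗮ.reflection (p.2 : E)

instance (e : E) : SFinite (hyperplaneMeasure e) := by
  unfold hyperplaneMeasure; infer_instance

lemma measurable_reflection (e : E) :
    Measurable fun p : Metric.sphere (0 : E) 1 × ((ℝ ∙ e)ᗮ : Submodule ℝ E) =>
      (ℝ ∙ (e - (p.1 : E)))ᗮ.reflection (p.2 : E) := by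
  simp only [Submodule.reflection_orthogonal_apply, Submodule.reflection_singleton_apply, two_smul,
    RCLike.ofReal_real_eq_id, id_eq]
  fun_prop

lemma lintegral_hyperplaneMeasure {e : E} (he : ‖e‖ = 1) {g : E → ENNReal} (hg : Measurable g) :
    ∫⁻ y, g y ∂hyperplaneMeasure e =
      ∫⁻ ξ : Metric.sphere (0 : E) 1, (∫⁻ y : ((ℝ ∙ (ξ : E))ᗮ : Submodule ℝ E), g y)
        ∂(volume : Measure E).toSphere := by
  rw [hyperplaneMeasure, lintegral_map hg (measurable_reflection e),
    lintegral_prod _ (by exact (hg.comp (measurable_reflection e)).aemeasurable)]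
  exact lintegral_congr fun ξ => lintegral_orthogonal_comp _ (reflection_sphere he ξ) g hg

lemma integral_hyperplaneMeasure {e : E} (he : ‖e‖ = 1) {g : E → ℝ}
    (hg : Integrable g (hyperplaneMeasure e)) :
    ∫ y, g y ∂hyperplaneMeasure e =
      ∫ ξ : Metric.sphere (0 : E) 1, (∫ y : ((ℝ ∙ (ξ : E))ᗮ : Submodule ℝ E), g y)
        ∂(volume : Measure E).toSphere := by
  have hg' := hg
  rw [hyperplaneMeasure] at hg' ⊢
  rw [integral_map (measurable_reflection e).aemeasurable hg'.1,
    integral_prod _ (by exact hg'.comp_measurable (measurable_reflection e))]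
  exact integral_congr_ae (.of_forall fun ξ => integral_orthogonal_comp _ (reflection_sphere he ξ) g)

lemma measurePreserving_hyperplaneMeasure {e : E} (he : ‖e‖ = 1) (U : E ≃ₗᵢ[ℝ] E) :
    MeasurePreserving U (hyperplaneMeasure e) (hyperplaneMeasure e) := by
  have hU : Measurable U := U.continuous.measurable
  refine ⟨hU, Measure.ext_of_lintegral _ fun g hg => ?_⟩
  have hmeas : Measurable fun ξ : Metric.sphere (0 : E) 1 =>
      ∫⁻ y : ((ℝ ∙ (ξ : E))ᗮ : Submodule ℝ E), g y := by
    simp only [← lintegral_orthogonal_comp _ (reflection_sphere he _) g hg]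
    exact (hg.comp (measurable_reflection e)).lintegral_prod_right'
  rw [lintegral_map hg hU, lintegral_hyperplaneMeasure (g := fun y => g (U y)) he (hg.comp hU),
    lintegral_hyperplaneMeasure he hg,
    ← (measurePreserving_sphere_linearIsometryEquiv U).lintegral_comp hmeas]
  exact lintegral_congr fun ξ => lintegral_orthogonal_comp U rfl g hg

/-- The hyperplane measure is a constant multiple of the measure with density `1/‖y‖`. -/
theorem hyperplaneMeasure_eq {e : E} (he : ‖e‖ = 1) (hE : 2 ≤ Module.finrank ℝ E) :
    hyperplaneMeasure e =
      (volume : Measure ((ℝ ∙ e)ᗮ : Submodule ℝ E)).toSphere Set.univ •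
        (volume : Measure E).withDensity fun y => ENNReal.ofReal ‖y‖⁻¹ := by
  have hd := finrank_orthogonal_singleton he
  have : Nontrivial E := Module.nontrivial_of_finrank_pos (R := ℝ) (by omega)
  have : Nontrivial ((ℝ ∙ e)ᗮ : Submodule ℝ E) :=
    Module.nontrivial_of_finrank_pos (R := ℝ) (by omega)
  have hdens : Measurable fun y : E => ENNReal.ofReal ‖y‖⁻¹ := by fun_prop
  refine Measure.ext_of_radial he (measurePreserving_hyperplaneMeasure he) (fun U => ?_)
    fun φ hφ => ?_
  · refine MeasurePreserving.smul_measure ⟨U.continuous.measurable, ?_⟩ _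
    refine Measure.ext_of_lintegral _ fun g hg => ?_
    have hU : Measurable U := U.continuous.measurable
    rw [lintegral_map hg hU,
      lintegral_withDensity_eq_lintegral_mul _ hdens (g := fun y => g (U y)) (hg.comp hU),
      lintegral_withDensity_eq_lintegral_mul _ hdens hg,
      ← U.measurePreserving.lintegral_comp (hdens.mul hg)]
    simp
  · have hφ' : Measurable fun y : E => φ ‖y‖ := hφ.comp measurable_norm
    rw [hyperplaneMeasure, lintegral_map hφ' (measurable_reflection e),
      lintegral_smul_measure, lintegral_withDensity_eq_lintegral_mul _ hdens hφ']
    simp only [LinearIsometryEquiv.norm_map, Pi.mul_apply]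
    rw [lintegral_prod _ (by fun_prop)]
    simp only [lintegral_const]
    have h1 := lintegral_fun_norm_addHaar (volume : Measure ((ℝ ∙ e)ᗮ : Submodule ℝ E)) hφ
    have h2 := lintegral_fun_norm_addHaar (volume : Measure E)
      (φ := fun r => ENNReal.ofReal r⁻¹ * φ r) (by fun_prop)
    simp only [Submodule.coe_norm] at h1
    rw [h1, h2, hd, smul_eq_mul]
    have : ∀ r ∈ Set.Ioi (0 : ℝ), ENNReal.ofReal (r ^ (Module.finrank ℝ E - 1)) *
        (ENNReal.ofReal r⁻¹ * φ r) = ENNReal.ofReal (r ^ (Module.finrank ℝ E - 1 - 1)) * φ r := by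
      intro r hr
      have hr : 0 < r := hr
      rw [← mul_assoc, ← ENNReal.ofReal_mul (by positivity)]
      obtain ⟨k, hk⟩ : ∃ k, Module.finrank ℝ E = k + 2 := ⟨_, (Nat.sub_add_cancel hE).symm⟩
      simp only [hk, Nat.add_sub_cancel, show k + 2 - 1 = k + 1 by omega]
      rw [pow_succ, mul_assoc, mul_inv_cancel₀ hr.ne', mul_one]
    rw [setLIntegral_congr_fun measurableSet_Ioi this]
    ring

/-- The surface area of the unit sphere. -/
lemma toSphere_univ_eq [Nontrivial E] :
    (volume : Measure E).toSphere Set.univ = ENNReal.ofReal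
      (2 * Real.pi ^ ((Module.finrank ℝ E : ℝ) / 2) / Real.Gamma ((Module.finrank ℝ E : ℝ) / 2)) := by
  have hpos : (0 : ℝ) < Module.finrank ℝ E := by exact_mod_cast Module.finrank_pos
  rw [Measure.toSphere_apply_univ, InnerProductSpace.volume_ball, Real.Gamma_add_one (by positivity),
    ENNReal.ofReal_one, one_pow, one_mul, ← ENNReal.ofReal_natCast,
    ← ENNReal.ofReal_mul (by positivity), Real.sqrt_eq_rpow, ← Real.rpow_mul_natCast Real.pi_pos.le]
  congr 1
  have := (Real.Gamma_pos_of_pos (half_pos hpos)).ne'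
  field_simp

/-- The product of the Riesz potential `‖·‖⁻¹` and a bounded integrable function is integrable. -/
lemma integrable_inv_norm_mul (hE : 2 ≤ Module.finrank ℝ E) {g : E → ℝ} (hg : Integrable g) {C : ℝ}
    (hC : ∀ y, ‖g y‖ ≤ C) : Integrable fun y => ‖y‖⁻¹ * g y := by
  have : Nontrivial E := Module.nontrivial_of_finrank_pos (R := ℝ) (by omega)
  have hball : IntegrableOn (fun y : E => ‖y‖⁻¹) (Metric.ball 0 1) := by
    rw [integrableOn_fun_norm_addHaar volume (f := fun r => r⁻¹)]
    refine Measure.integrableOn_of_bounded (M := 1) (by simp) (by fun_prop) ?_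
    filter_upwards [ae_restrict_mem measurableSet_Ioo] with r hr
    obtain ⟨k, hk⟩ : ∃ k, Module.finrank ℝ E = k + 2 := ⟨_, (Nat.sub_add_cancel hE).symm⟩
    rw [hk, show k + 2 - 1 = k + 1 by omega, pow_succ, smul_eq_mul, mul_assoc,
      mul_inv_cancel₀ hr.1.ne', mul_one, norm_pow, Real.norm_of_nonneg hr.1.le]
    exact pow_le_one₀ hr.1.le hr.2.le
  rw [← integrableOn_univ, ← Set.union_compl_self (Metric.ball (0 : E) 1)]
  refine IntegrableOn.union ?_ ?_
  · exact hball.mul_bdd (c := C) hg.1.restrict (.of_forall hC)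
  · refine hg.integrableOn.bdd_mul (c := 1) (by fun_prop) ?_
    filter_upwards [ae_restrict_mem Metric.isOpen_ball.measurableSet.compl] with y hy
    have hy : 1 ≤ ‖y‖ := by simpa using hy
    rw [norm_inv, norm_norm]
    exact inv_le_one_of_one_le₀ hy

/-- The tomogram along `ξ` at distance `⟪ξ, x⟫` integrates over the hyperplane through `x`. -/
lemma tomogram_inner {n : ℕ} (f : EuclideanSpace ℝ (Fin n) → ℝ) (x : EuclideanSpace ℝ (Fin n))
    (ξ : Metric.sphere (0 : EuclideanSpace ℝ (Fin n)) 1) :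
    tomogram f ξ ⟪(ξ : EuclideanSpace ℝ (Fin n)), x⟫ =
      ∫ y : ((ℝ ∙ (ξ : EuclideanSpace ℝ (Fin n)))ᗮ :
        Submodule ℝ (EuclideanSpace ℝ (Fin n))), f (x + y) := by
  have hξ : ‖(ξ : EuclideanSpace ℝ (Fin n))‖ = 1 := by simp
  let p : ((ℝ ∙ (ξ : EuclideanSpace ℝ (Fin n)))ᗮ : Submodule ℝ (EuclideanSpace ℝ (Fin n))) :=
    ⟨x - ⟪(ξ : EuclideanSpace ℝ (Fin n)), x⟫ • (ξ : EuclideanSpace ℝ (Fin n)), by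
      rw [Submodule.mem_orthogonal_singleton_iff_inner_right, inner_sub_right, inner_smul_right,
        real_inner_self_eq_norm_sq, hξ]
      ring⟩
  rw [tomogram, ← integral_add_left_eq_self _ p]
  congr 1 with y
  congr 1
  simp only [Submodule.coe_add, p]
  abel

/-- `(f^♯)^♭ = aₙ (f * V)` with `V(x) = 1/|x|` and
`aₙ = 2π^{(n-1)/2}/Γ((n-1)/2)`. -/
theorem backproj_radon_eq_conv_riesz {n : ℕ} (hn : 2 ≤ n)
    (f : SchwartzMap (EuclideanSpace ℝ (Fin n)) ℝ) (x : EuclideanSpace ℝ (Fin n)) :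
    backprojRadon (fun y => f y) x
      = (2 * Real.pi ^ ((n - 1 : ℝ) / 2) / Real.Gamma ((n - 1 : ℝ) / 2)) *
        ∫ y : EuclideanSpace ℝ (Fin n), f y / ‖x - y‖ := by
  have hE : 2 ≤ Module.finrank ℝ (EuclideanSpace ℝ (Fin n)) := by simpa using hn
  let e : EuclideanSpace ℝ (Fin n) := EuclideanSpace.single ⟨0, by omega⟩ 1
  have he : ‖e‖ = 1 := by simp [e]
  have hd := finrank_orthogonal_singleton he
  have : Nontrivial ((ℝ ∙ e)ᗮ : Submodule ℝ (EuclideanSpace ℝ (Fin n))) :=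
    Module.nontrivial_of_finrank_pos (R := ℝ) (by omega)
  have hd' : ((Module.finrank ℝ ((ℝ ∙ e)ᗮ : Submodule ℝ (EuclideanSpace ℝ (Fin n))) : ℕ) : ℝ)
      = n - 1 := by
    rw [hd, finrank_euclideanSpace_fin, Nat.cast_sub (by omega), Nat.cast_one]
  have hn1 : (0 : ℝ) < n - 1 := by
    have : (2 : ℝ) ≤ n := by exact_mod_cast hn
    linarith
  have hdens : Measurable fun y : EuclideanSpace ℝ (Fin n) => ‖y‖₊⁻¹ := by fun_prop
  have hmeas : hyperplaneMeasure e = ENNReal.ofReal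
      (2 * Real.pi ^ ((n - 1 : ℝ) / 2) / Real.Gamma ((n - 1 : ℝ) / 2)) •
      (volume : Measure (EuclideanSpace ℝ (Fin n))).withDensity fun y =>
        ((‖y‖₊⁻¹ : NNReal) : ENNReal) := by
    rw [hyperplaneMeasure_eq he hE, toSphere_univ_eq, hd']
    congr 2 with y
    rw [← ENNReal.ofReal_coe_nnreal]
    simp
  obtain ⟨C, hC⟩ := f.decay 0 0
  have hint : Integrable fun y => ‖y‖⁻¹ * f (x + y) :=
    integrable_inv_norm_mul hE (f.integrable.comp_add_left x) (C := C) fun y => by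
      simpa using hC.2 (x + y)
  have hint' : Integrable (fun y => f (x + y)) (hyperplaneMeasure e) := by
    rw [hmeas]
    refine Integrable.smul_measure ?_ ENNReal.ofReal_ne_top
    rw [integrable_withDensity_iff_integrable_smul hdens]
    exact hint
  calc backprojRadon (fun y => f y) x
      = ∫ y, f (x + y) ∂hyperplaneMeasure e := by
        simp only [backprojRadon, tomogram_inner]
        exact (integral_hyperplaneMeasure he hint').symm
    _ = (2 * Real.pi ^ ((n - 1 : ℝ) / 2) / Real.Gamma ((n - 1 : ℝ) / 2)) *
        ∫ y : EuclideanSpace ℝ (Fin n), ‖y‖⁻¹ * f (x + y) := by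
        have := Real.Gamma_pos_of_pos (half_pos hn1)
        rw [hmeas, integral_smul_measure, integral_withDensity_eq_integral_smul hdens,
          ENNReal.toReal_ofReal (by positivity)]
        rfl
    _ = _ := by
        congr 1
        rw [← integral_add_left_eq_self (fun y => f y / ‖x - y‖) x]
        congr 1 with y
        simp [div_eq_inv_mul]
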